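/- arXiv:1607.00255 — 4 statements merged into one kernel-verified Lean document; each statement's English description precedes it below -/
import Mathlib

section
/- (Theorem, W-GMRES(1) part) Let A = diag(λ, 1) be the 2×2 real diagonal matrix with λ ∈ ℝ, λ ≠ 0, and let b = (b₁, b₂) ∈ ℝ² with b₁ ≠ 0; set β := b₂/b₁ and S := diag(√|b₁|, √|b₂|) (Essai's weighting). Then the function t ↦ ‖S(b − t·A b)‖₂² has a unique minimizer t* over ℝ, given by t* = (λ + |β|³)/(λ² + |β|³); hence if λ + |β|³ ≠ 0, the W-GMRES(1) residual polynomial φ(z) = 1 − t* z has the root 1/t* = (λ² + |β|³)/(λ + |β|³). -/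
open Matrix

/-- Euclidean (2-)norm of a vector in ℝⁿ. -/
noncomputable def eNormR {n : ℕ} (v : Fin n → ℝ) : ℝ :=
  ‖(WithLp.equiv 2 (Fin n → ℝ)).symm v‖

/-- The weighted squared residual norm as an explicit quadratic in the step length. -/
theorem eNormR_sq_weighted_residual (lam t : ℝ) (b : Fin 2 → ℝ) (hb : b 0 ≠ 0) :
    eNormR ((diagonal ![Real.sqrt |b 0|, Real.sqrt |b 1|]).mulVec
      (b - t • (diagonal ![lam, 1]).mulVec b)) ^ 2 =
      |b 0| ^ 3 * ((1 - t * lam) ^ 2 + |b 1 / b 0| ^ 3 * (1 - t) ^ 2) := by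
  have h : |b 0| ≠ 0 := abs_ne_zero.mpr hb
  rw [eNormR, EuclideanSpace.norm_sq_eq, Fin.sum_univ_two]
  simp only [WithLp.equiv_symm_apply, mulVec_diagonal, Pi.sub_apply, Pi.smul_apply, smul_eq_mul,
    Real.norm_eq_abs, sq_abs, cons_val_zero, cons_val_one, mul_pow, Real.sq_sqrt (abs_nonneg _)]
  rw [abs_div, div_pow]
  field_simp
  rw [pow_succ |b 0| 2, pow_succ |b 1| 2, sq_abs, sq_abs]
  ring

/-- W-GMRES(1) with Essai's weighting `S = diag(√|b₁|, √|b₂|)` for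
`A = diag(λ, 1)`, `b = (b₁, b₂)` with `b₁ ≠ 0`, `β = b₂/b₁`:
the function `t ↦ ‖S(b − t A b)‖₂²` has the unique minimizer
`t* = (λ + |β|³)/(λ² + |β|³)`; hence if `λ + |β|³ ≠ 0` the W-GMRES(1)
residual polynomial `1 − t* z` has the root `(λ² + |β|³)/(λ + |β|³)`. -/
theorem wgmres1_root_diag2x2 (lam : ℝ) (hlam : lam ≠ 0)
    (b : Fin 2 → ℝ) (hb : b 0 ≠ 0) (β : ℝ) (hβ : β = b 1 / b 0)
    (A : Matrix (Fin 2) (Fin 2) ℝ) (hA : A = diagonal ![lam, 1])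
    (S : Matrix (Fin 2) (Fin 2) ℝ)
    (hS : S = diagonal ![Real.sqrt |b 0|, Real.sqrt |b 1|])
    (tstar : ℝ) (htstar : tstar = (lam + |β| ^ 3) / (lam ^ 2 + |β| ^ 3)) :
    (∀ t : ℝ, t ≠ tstar →
      eNormR (S.mulVec (b - tstar • A.mulVec b)) ^ 2
        < eNormR (S.mulVec (b - t • A.mulVec b)) ^ 2) ∧
    (lam + |β| ^ 3 ≠ 0 →
      1 - tstar * ((lam ^ 2 + |β| ^ 3) / (lam + |β| ^ 3)) = 0) := by
  subst hA hS
  have hD : 0 < lam ^ 2 + |β| ^ 3 := by positivity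
  have ht : tstar * (lam ^ 2 + |β| ^ 3) = lam + |β| ^ 3 := by
    rw [htstar, div_mul_cancel₀ _ hD.ne']
  refine ⟨fun t hne => ?_, fun h => ?_⟩
  · rw [eNormR_sq_weighted_residual _ _ _ hb, eNormR_sq_weighted_residual _ _ _ hb, ← hβ]
    refine mul_lt_mul_of_pos_left ?_ (by positivity)
    have hpos : 0 < (lam ^ 2 + |β| ^ 3) * (t - tstar) ^ 2 :=
      mul_pos hD (sq_pos_of_ne_zero (sub_ne_zero.mpr hne))
    linear_combination hpos - 2 * (t - tstar) * ht
  · rw [mul_div_assoc', ht, div_self h, sub_self]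
end

section
/- Let A = diag(2, 1) be the 2×2 real diagonal matrix and let r₀ = (1, 1) ∈ ℝ². Then: (i) the unique minimizer over t ∈ ℝ of ‖r₀ − t·A r₀‖₂ is t₀ = 3/5, so the first GMRES(1) residual polynomial 1 − (3/5)z has root 5/3; (ii) with r₁ := r₀ − (3/5)·A r₀ = (−1/5, 2/5), the unique minimizer over t ∈ ℝ of ‖r₁ − t·A r₁‖₂ is t₁ = 3/4, so the second residual polynomial 1 − (3/4)z has root 4/3; and (iii) r₂ := r₁ − (3/4)·A r₁ = (1/10)·r₀, so the GMRES(1) residual direction repeats exactly with period two. -/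
open Matrix

theorem eNormR_vec2 (a b : ℝ) : eNormR ![a, b] = √(a ^ 2 + b ^ 2) := by
  simp [eNormR, EuclideanSpace.norm_eq, Fin.sum_univ_two]

theorem eNormR_vec2_lt {a b c d : ℝ} (h : a ^ 2 + b ^ 2 < c ^ 2 + d ^ 2) :
    eNormR ![a, b] < eNormR ![c, d] := by
  rw [eNormR_vec2, eNormR_vec2]
  exact Real.sqrt_lt_sqrt (by positivity) h

theorem sub_smul_diagonal_mulVec_vec2 (p q a b t : ℝ) :
    ![a, b] - t • (diagonal ![p, q]).mulVec ![a, b] =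
      ![a - t * (p * a), b - t * (q * b)] := by
  ext i
  fin_cases i <;> simp

/-- GMRES(1) for `A = diag(2, 1)` and `r₀ = (1, 1)`:
(i) the unique minimizer of `t ↦ ‖r₀ − t A r₀‖₂` is `t₀ = 3/5`, and the
first residual polynomial `1 − (3/5)z` has root `5/3`;
(ii) with `r₁ = r₀ − (3/5) A r₀ = (−1/5, 2/5)`, the unique minimizer of
`t ↦ ‖r₁ − t A r₁‖₂` is `t₁ = 3/4`, and the second residual polynomial
`1 − (3/4)z` has root `4/3`;
(iii) `r₂ = r₁ − (3/4) A r₁ = (1/10) r₀`: the residual direction repeats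
exactly with period two. -/
theorem gmres1_diag21_cycle (A : Matrix (Fin 2) (Fin 2) ℝ)
    (hA : A = diagonal ![2, 1]) (r₀ : Fin 2 → ℝ) (hr₀ : r₀ = ![1, 1])
    (r₁ : Fin 2 → ℝ) (hr₁ : r₁ = r₀ - (3/5 : ℝ) • A.mulVec r₀)
    (r₂ : Fin 2 → ℝ) (hr₂ : r₂ = r₁ - (3/4 : ℝ) • A.mulVec r₁) :
    (∀ t : ℝ, t ≠ 3/5 →
      eNormR (r₀ - (3/5 : ℝ) • A.mulVec r₀) < eNormR (r₀ - t • A.mulVec r₀)) ∧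
    (1 - (3/5 : ℝ) * (5/3) = 0) ∧
    r₁ = ![-1/5, 2/5] ∧
    (∀ t : ℝ, t ≠ 3/4 →
      eNormR (r₁ - (3/4 : ℝ) • A.mulVec r₁) < eNormR (r₁ - t • A.mulVec r₁)) ∧
    (1 - (3/4 : ℝ) * (4/3) = 0) ∧
    r₂ = (1/10 : ℝ) • r₀ := by
  have hr₁' : r₁ = ![-1/5, 2/5] := by
    rw [hr₁, hA, hr₀, sub_smul_diagonal_mulVec_vec2]
    norm_num
  refine ⟨fun t ht => ?_, by norm_num, hr₁', fun t ht => ?_, by norm_num, ?_⟩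
  · rw [hA, hr₀, sub_smul_diagonal_mulVec_vec2, sub_smul_diagonal_mulVec_vec2]
    apply eNormR_vec2_lt
    have := sq_pos_of_ne_zero (sub_ne_zero.mpr ht)
    linarith
  · rw [hA, hr₁', sub_smul_diagonal_mulVec_vec2, sub_smul_diagonal_mulVec_vec2]
    apply eNormR_vec2_lt
    have := sq_pos_of_ne_zero (sub_ne_zero.mpr ht)
    linarith
  · rw [hr₂, hA, hr₁', hr₀, sub_smul_diagonal_mulVec_vec2]
    norm_num
end

section
/- Let β := (5 + √5)/10, let A be the 2×2 real matrix with rows (1, −4) and (0, 5), let r₀ := (1, β) ∈ ℝ², and let S := diag(1, √β). Then r₀ᵀ S² A r₀ = 1 − 4β + 5β³ = 0, and consequently for every t ∈ ℝ, ‖S(r₀ − t·A r₀)‖₂ ≥ ‖S r₀‖₂; that is, W-GMRES(1) with this weighting makes no progress from r₀ (the cycle returns r₁ = r₀, complete stagnation). -/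
open Matrix

/-- Moving from `v` in a direction orthogonal to `v` does not decrease the Euclidean norm. -/
theorem eNormR_le_eNormR_sub_smul {n : ℕ} {v w : Fin n → ℝ} (h : v ⬝ᵥ w = 0) (t : ℝ) :
    eNormR v ≤ eNormR (v - t • w) := by
  have hsq (u : Fin n → ℝ) : eNormR u = Real.sqrt (u ⬝ᵥ u) := by
    simp [eNormR, EuclideanSpace.norm_eq, dotProduct, sq]
  rw [hsq, hsq]
  apply Real.sqrt_le_sqrt
  have hw : 0 ≤ w ⬝ᵥ w := Finset.sum_nonneg fun i _ => mul_self_nonneg (w i)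
  have h' : w ⬝ᵥ v = 0 := by rw [dotProduct_comm, h]
  simp only [sub_dotProduct, dotProduct_sub, smul_dotProduct, dotProduct_smul, h, h', smul_eq_mul]
  nlinarith [mul_nonneg (mul_self_nonneg t) hw]

/-- Complete stagnation of W-GMRES(1): with `β = (5 + √5)/10`,
`A = [[1, −4], [0, 5]]`, `r₀ = (1, β)`, and `S = diag(1, √β)`, one has
`r₀ᵀ S² A r₀ = 1 − 4β + 5β³ = 0`, and consequently for every `t ∈ ℝ`,
`‖S(r₀ − t A r₀)‖₂ ≥ ‖S r₀‖₂`: the weighted cycle makes no progress. -/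
theorem wgmres1_complete_stagnation (β : ℝ) (hβ : β = (5 + Real.sqrt 5) / 10)
    (A : Matrix (Fin 2) (Fin 2) ℝ) (hA : A = !![1, -4; 0, 5])
    (r₀ : Fin 2 → ℝ) (hr₀ : r₀ = ![1, β])
    (S : Matrix (Fin 2) (Fin 2) ℝ) (hS : S = diagonal ![1, Real.sqrt β]) :
    r₀ ⬝ᵥ (S * S * A).mulVec r₀ = 1 - 4 * β + 5 * β ^ 3 ∧
    1 - 4 * β + 5 * β ^ 3 = 0 ∧
    ∀ t : ℝ, eNormR (S.mulVec r₀) ≤ eNormR (S.mulVec (r₀ - t • A.mulVec r₀)) := by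
  have h5 : Real.sqrt 5 ^ 2 = 5 := Real.sq_sqrt (by norm_num)
  have hβ0 : 0 ≤ β := by rw [hβ]; positivity
  have hsβ : Real.sqrt β * Real.sqrt β = β := Real.mul_self_sqrt hβ0
  have hroot : 5 * β ^ 2 - 5 * β + 1 = 0 := by
    rw [hβ]; linear_combination h5 / 20
  have hpoly : 1 - 4 * β + 5 * β ^ 3 = 0 := by
    linear_combination (β + 1) * hroot
  have hSS : S * S = diagonal ![1, β] := by
    rw [hS, diagonal_mul_diagonal]
    congr 1
    ext i
    fin_cases i <;> simp [hsβ]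
  have hdot : r₀ ⬝ᵥ (S * S * A).mulVec r₀ = 1 - 4 * β + 5 * β ^ 3 := by
    rw [hSS, hA, hr₀]
    simp [dotProduct, mulVec, mul_apply, diagonal_apply, Fin.sum_univ_two]
    ring
  refine ⟨hdot, hpoly, fun t => ?_⟩
  rw [mulVec_sub, mulVec_smul]
  apply eNormR_le_eNormR_sub_smul
  have hST : Sᵀ = S := by rw [hS, diagonal_transpose]
  rw [← hpoly, ← hdot, ← mulVec_mulVec, ← mulVec_mulVec, dotProduct_mulVec r₀ S,
    ← mulVec_transpose, hST]
end

section
/- Let β := (5 + √5)/10, let A be the 2×2 complex matrix with rows (1, −4) and (0, 5), let S := diag(1, √β), and set M := S A S⁻¹. Then for every v ∈ ℂ², (3 − √(14 − 2√5))·‖v‖₂² ≤ Re(v* M v) ≤ (3 + √(14 − 2√5))·‖v‖₂², and moreover 3 − √(14 − 2√5) < 0, so the real part of the field of values of M extends to the left of the origin. -/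
open Matrix

/-- Euclidean (2-)norm of a vector in ℂⁿ. -/
noncomputable def eNormC {n : ℕ} (v : Fin n → ℂ) : ℝ :=
  ‖(WithLp.equiv 2 (Fin n → ℂ)).symm v‖

theorem two_mul_le_weighted_sq_add_sq {p q s : ℝ} (hp : 0 < p) (h : p * q = s ^ 2) (a b : ℝ) :
    2 * s * (a * b) ≤ p * a ^ 2 + q * b ^ 2 := by
  have key : p * (p * a ^ 2 + q * b ^ 2 - 2 * s * (a * b)) = (p * a - s * b) ^ 2 := by
    linear_combination b ^ 2 * h
  have := nonneg_of_mul_nonneg_right (key ▸ sq_nonneg (p * a - s * b)) hp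
  linarith

theorem eNormC_fin_two_sq (v : Fin 2 → ℂ) :
    eNormC v ^ 2 = (v 0).re ^ 2 + (v 0).im ^ 2 + ((v 1).re ^ 2 + (v 1).im ^ 2) := by
  simp [eNormC, EuclideanSpace.norm_sq_eq, Fin.sum_univ_two, Complex.sq_norm,
    Complex.normSq_apply, ← pow_two]

theorem diagonal_conj_upper_triangular {t : ℂ} (ht : t ≠ 0) (a b d : ℂ) :
    diagonal ![1, t] * !![a, b; 0, d] * (diagonal ![1, t])⁻¹ = !![a, b * t⁻¹; 0, d] := by
  have hinv : (diagonal ![1, t])⁻¹ = diagonal ![1, t⁻¹] := by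
    apply Matrix.inv_eq_right_inv
    ext i j
    fin_cases i <;> fin_cases j <;> simp [ht]
  rw [hinv]
  ext i j
  fin_cases i <;> fin_cases j <;> simp [Matrix.mul_apply, diagonal_apply]
  field_simp

/-- With `β = (5 + √5)/10`, `A = [[1, −4], [0, 5]]`, `S = diag(1, √β)`, and
`M = S A S⁻¹`: for every `v ∈ ℂ²`,
`(3 − √(14 − 2√5))‖v‖₂² ≤ Re(v* M v) ≤ (3 + √(14 − 2√5))‖v‖₂²`, and moreover
`3 − √(14 − 2√5) < 0`, so the real part of the field of values of `M`
extends to the left of the origin. -/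
theorem fov_real_part_bounds_weighted_matrix (β : ℝ)
    (hβ : β = (5 + Real.sqrt 5) / 10)
    (A : Matrix (Fin 2) (Fin 2) ℂ) (hA : A = !![1, -4; 0, 5])
    (S : Matrix (Fin 2) (Fin 2) ℂ)
    (hS : S = diagonal ![1, (Real.sqrt β : ℂ)])
    (M : Matrix (Fin 2) (Fin 2) ℂ) (hM : M = S * A * S⁻¹) :
    (∀ v : Fin 2 → ℂ,
      (3 - Real.sqrt (14 - 2 * Real.sqrt 5)) * eNormC v ^ 2
          ≤ (star v ⬝ᵥ M.mulVec v).re ∧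
      (star v ⬝ᵥ M.mulVec v).re
          ≤ (3 + Real.sqrt (14 - 2 * Real.sqrt 5)) * eNormC v ^ 2) ∧
    3 - Real.sqrt (14 - 2 * Real.sqrt 5) < 0 := by
  subst hβ hA hS hM
  set β : ℝ := (5 + Real.sqrt 5) / 10 with hβ
  set r : ℝ := Real.sqrt (14 - 2 * Real.sqrt 5) with hr
  have h5 : Real.sqrt 5 ^ 2 = 5 := Real.sq_sqrt (by norm_num)
  have h5_nonneg : 0 ≤ Real.sqrt 5 := Real.sqrt_nonneg 5
  have h5_lt : Real.sqrt 5 < 5 / 2 := by nlinarith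
  have hr_sq : r ^ 2 = 14 - 2 * Real.sqrt 5 := Real.sq_sqrt (by linarith)
  have hr_gt : 3 < r := Real.lt_sqrt_of_sq_lt (by linarith)
  have hβ_pos : 0 < β := by positivity
  have hsqrt_pos : 0 < Real.sqrt β := Real.sqrt_pos.mpr hβ_pos
  obtain ⟨c, hc⟩ : ∃ c : ℝ, c = (Real.sqrt β)⁻¹ := ⟨_, rfl⟩
  have hc_sq : c ^ 2 = (5 - Real.sqrt 5) / 2 := by
    rw [hc, inv_pow, Real.sq_sqrt hβ_pos.le, inv_eq_iff_eq_inv]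
    apply eq_inv_of_mul_eq_one_left
    rw [hβ]
    linear_combination (-1 / 20) * h5
  have hprod : (r - 2) * (r + 2) = (2 * c) ^ 2 := by
    linear_combination hr_sq - 4 * hc_sq
  have hprod_neg : (r + 2) * (r - 2) = (-(2 * c)) ^ 2 := by
    linear_combination hprod
  refine ⟨fun v => ?_, by linarith⟩
  have hform : (star v ⬝ᵥ (diagonal ![1, (Real.sqrt β : ℂ)] * !![1, -4; 0, 5] *
      (diagonal ![1, (Real.sqrt β : ℂ)])⁻¹).mulVec v).re =
      (v 0).re ^ 2 + (v 0).im ^ 2 + 5 * ((v 1).re ^ 2 + (v 1).im ^ 2) -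
        4 * c * ((v 0).re * (v 1).re + (v 0).im * (v 1).im) := by
    rw [diagonal_conj_upper_triangular (by exact_mod_cast hsqrt_pos.ne'), ← Complex.ofReal_inv,
      ← hc]
    simp [dotProduct, Matrix.mulVec, Fin.sum_univ_two]
    ring
  rw [hform, eNormC_fin_two_sq]
  constructor
  · linarith [two_mul_le_weighted_sq_add_sq (by linarith) hprod (v 0).re (v 1).re,
      two_mul_le_weighted_sq_add_sq (by linarith) hprod (v 0).im (v 1).im]
  · linarith [two_mul_le_weighted_sq_add_sq (by linarith) hprod_neg (v 0).re (v 1).re,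
      two_mul_le_weighted_sq_add_sq (by linarith) hprod_neg (v 0).im (v 1).im]
end
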